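/- arXiv:1909.07674 — 10 statements merged into one kernel-verified Lean document; each statement's English description precedes it below -/
import Mathlib

section
/- Let B be a finite bounded integral commutative residuated lattice, W a set, P : W × W → B, and f : W → B. Then for every v ∈ W, ⋀_{b ∈ B} ((⋁_{w ∈ W} P(v,w) ⊙ (f(w) → b)) → b) = ⋀_{w ∈ W} (P(v,w) → f(w)). (All infima and suprema exist since all values lie in the finite lattice B.) -/
/-- Multiplication in a residuated lattice is monotone in its second argument. -/
theorem mul_le_mul_left_of_residuated {B : Type*} [CompleteLattice B] [CommMonoid B]
    {himp : B → B → B} (hres : ∀ x y z : B, x * y ≤ z ↔ x ≤ himp y z)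
    {x y : B} (h : x ≤ y) (z : B) : z * x ≤ z * y := by
  rw [mul_comm z x, hres]
  exact h.trans ((hres _ _ _).1 (mul_comm y z).le)

/-- □ is definable from ◇ and truth constants:
⋀_{b ∈ B} ((⋁_{w ∈ W} P(v,w) ⊙ (f(w) → b)) → b) = ⋀_{w ∈ W} (P(v,w) → f(w)). -/
theorem stmt1 (B : Type*) [Fintype B] [CompleteLattice B] [CommMonoid B]
    (himp : B → B → B)
    (hone : (1 : B) = ⊤)
    (hres : ∀ x y z : B, x * y ≤ z ↔ x ≤ himp y z)
    (W : Type*) (P : W → W → B) (f : W → B) (v : W) :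
    (⨅ b : B, himp (⨆ w : W, P v w * himp (f w) b) b)
      = ⨅ w : W, himp (P v w) (f w) := by
  apply le_antisymm
  · refine le_iInf fun w => (iInf_le _ (f w)).trans ?_
    have hP : P v w ≤ ⨆ u : W, P v u * himp (f u) (f w) := by
      refine le_trans ?_ (le_iSup (fun u : W => P v u * himp (f u) (f w)) w)
      have h1 : (1 : B) ≤ himp (f w) (f w) := (hres _ _ _).1 (one_mul _).le
      simpa using mul_le_mul_left_of_residuated hres h1 (P v w)
    exact (hres _ _ _).1
      ((mul_le_mul_left_of_residuated hres hP _).trans ((hres _ _ _).2 le_rfl))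
  · refine le_iInf fun b => ?_
    rw [← hres, mul_comm, hres]
    refine iSup_le fun w => ?_
    rw [← hres]
    have hf : (⨅ u : W, himp (P v u) (f u)) * P v w ≤ f w :=
      (hres _ _ _).2 (iInf_le _ w)
    calc P v w * himp (f w) b * (⨅ u : W, himp (P v u) (f u))
        = himp (f w) b * ((⨅ u : W, himp (P v u) (f u)) * P v w) := by
          rw [mul_comm (P v w), mul_assoc, mul_comm (P v w)]
      _ ≤ himp (f w) b * f w := mul_le_mul_left_of_residuated hres hf _
      _ ≤ b := (hres _ _ _).2 le_rfl
end

section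
/- Let B be a finite bounded integral commutative residuated lattice, W a set, P : W × W → B, and f : W → B. Then for every v ∈ W, ⋀_{b ∈ B} ((⋀_{w ∈ W} (P(v,w) → (f(w) → b))) → b) = ⋁_{w ∈ W} (P(v,w) ⊙ f(w)). (All infima and suprema exist since all values lie in the finite lattice B.) -/
/-- ◇ is definable from □ and truth constants:
⋀_{b ∈ B} ((⋀_{w ∈ W} (P(v,w) → (f(w) → b))) → b) = ⋁_{w ∈ W} (P(v,w) ⊙ f(w)). -/
theorem stmt2 (B : Type*) [Fintype B] [CompleteLattice B] [CommMonoid B]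
    (himp : B → B → B)
    (hone : (1 : B) = ⊤)
    (hres : ∀ x y z : B, x * y ≤ z ↔ x ≤ himp y z)
    (W : Type*) (P : W → W → B) (f : W → B) (v : W) :
    (⨅ b : B, himp (⨅ w : W, himp (P v w) (himp (f w) b)) b)
      = ⨆ w : W, P v w * f w := by
  apply le_antisymm
  · have htop : (⨅ w : W, himp (P v w) (himp (f w) (⨆ w : W, P v w * f w))) = 1 := by
      rw [hone, eq_top_iff, ← hone]
      refine le_iInf fun w => ?_
      rw [← hres, ← hres, one_mul]
      exact le_iSup (fun w => P v w * f w) w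
    have h := iInf_le
      (fun b : B => himp (⨅ w : W, himp (P v w) (himp (f w) b)) b) (⨆ w : W, P v w * f w)
    simp only [htop] at h
    rwa [← hres, mul_one] at h
  · refine iSup_le fun w => le_iInf fun b => ?_
    rw [← hres, mul_comm, ← mul_assoc, hres, hres]
    exact iInf_le (fun w => himp (P v w) (himp (f w) b)) w
end

section
/- Let B be a finite linearly ordered set with least element 0 and greatest element 1, W a set, and P : W × W → B a ∧-transitive map (P(u,v) ∧ P(v,w) ≤ P(u,w) for all u, v, w). Then its strict part P^< is also ∧-transitive: P^<(u,v) ∧ P^<(v,w) ≤ P^<(u,w) for all u, v, w; moreover P^< is antisymmetric in the sense that P^<(u,v) > 0 implies P^<(v,u) = 0. -/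
/-- The strict part of a ∧-transitive B-valued relation is ∧-transitive and
antisymmetric: P^<(u,v) > 0 implies P^<(v,u) = 0. -/
theorem stmt5 (B : Type*) [Fintype B] [LinearOrder B] [OrderBot B] [OrderTop B]
    (W : Type*) (P : W → W → B)
    (htrans : ∀ u v w, min (P u v) (P v w) ≤ P u w)
    (Ps : W → W → B)
    (hPs : ∀ u v, Ps u v = if P v u < P u v then P u v else ⊥) :
    (∀ u v w, min (Ps u v) (Ps v w) ≤ Ps u w)
      ∧ (∀ u v, ⊥ < Ps u v → Ps v u = ⊥) := by
  refine ⟨fun u v w => ?_, fun u v h => ?_⟩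
  · rw [hPs u v, hPs v w, hPs u w]
    by_cases huv : P v u < P u v
    · by_cases hvw : P w v < P v w
      · have huw : P w u < P u w := by
          by_contra! hle
          have hwu : min (P u v) (P v w) ≤ P w u := (htrans u v w).trans hle
          rcases le_total (P u v) (P v w) with hab | hba
          · rw [min_eq_left hab] at hwu
            exact huv.not_ge ((le_min hab hwu).trans (htrans v w u))
          · rw [min_eq_right hba] at hwu
            exact hvw.not_ge ((le_min hwu hba).trans (htrans w u v))
        rw [if_pos huv, if_pos hvw, if_pos huw]
        exact htrans u v w
      · simp [hvw]
    · simp [huv]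
  · rw [hPs] at h
    rw [hPs, if_neg]
    intro hvu
    simp [hvu.not_gt] at h
end

section
/- Let B be a finite MTL-chain, P a B-valued ∧-preorder on a set W, f : W → B, and v ∈ W. Then ⋀_{b ∈ B, b ≠ 0} ( b → ⋀_{w ∈ W : v ≺_b w} f(w) ) = ⋀_{w ∈ W} ( P^<(v,w) → f(w) ), where an infimum over an empty family equals 1. -/
/-- ⋀_{b ∈ B, b ≠ 0} ( b → ⋀_{w : v ≺_b w} f(w) ) = ⋀_{w ∈ W} ( P^<(v,w) → f(w) ),
where an infimum over an empty family equals 1 (= ⊤). -/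
theorem stmt7 (B : Type*) [Fintype B] [CompleteLinearOrder B] [CommMonoid B]
    (himp : B → B → B)
    (hone : (1 : B) = ⊤)
    (hres : ∀ x y z : B, x * y ≤ z ↔ x ≤ himp y z)
    (W : Type*) (P : W → W → B)
    (hrefl : ∀ u, P u u = 1)
    (htrans : ∀ u v w, min (P u v) (P v w) ≤ P u w)
    (f : W → B) (v : W) :
    (⨅ b : B, ⨅ (_ : b ≠ ⊥), himp b (⨅ w : W, ⨅ (_ : b ≤ P v w ∧ P w v < b), f w))
      = ⨅ w : W, himp (if P w v < P v w then P v w else ⊥) (f w) := by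
  have hmono : ∀ c x y : B, x ≤ y → c * x ≤ c * y := by
    intro c x y hxy
    rw [mul_comm c x, hres]
    exact hxy.trans ((hres _ _ _).1 (mul_comm y c).le)
  refine eq_of_forall_le_iff fun c => ?_
  simp only [le_iInf_iff, ← hres]
  constructor
  · intro h w
    split_ifs with hw
    · exact h _ hw.ne_bot w ⟨le_rfl, hw⟩
    · rw [mul_comm, hres]
      exact bot_le
  · rintro h b - w ⟨hb, hw⟩
    have hc := h w
    rw [if_pos (hw.trans_le hb)] at hc
    exact (hmono c _ _ hb).trans hc
end

section
/- Let B be a finite MTL-chain, P a B-valued ∧-preorder on a set W, b ∈ B with b ≠ 0, c ∈ B, f, g : W → B, and v ∈ W. Then (⋀_{w : v ≺_b w} f(w)) ∧ (g(v) → c) ≤ ⋀_{w : v ⪯_b w} ( f(w) ∨ ((⋀_{u : w ⪯_b u} g(u)) → c) ), where infima over empty families equal 1. (Soundness of the Interaction 3 axiom.) -/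
/-- Soundness of the Interaction 3 axiom:
(⋀_{w : v ≺_b w} f(w)) ∧ (g(v) → c) ≤
  ⋀_{w : v ⪯_b w} ( f(w) ∨ ((⋀_{u : w ⪯_b u} g(u)) → c) ). -/
theorem stmt10 (B : Type*) [Fintype B] [CompleteLinearOrder B] [CommMonoid B]
    (himp : B → B → B)
    (hone : (1 : B) = ⊤)
    (hres : ∀ x y z : B, x * y ≤ z ↔ x ≤ himp y z)
    (W : Type*) (P : W → W → B)
    (hrefl : ∀ u, P u u = 1)
    (htrans : ∀ u v w, min (P u v) (P v w) ≤ P u w)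
    (b : B) (hb : b ≠ ⊥) (c : B) (f g : W → B) (v : W) :
    (⨅ w : W, ⨅ (_ : b ≤ P v w ∧ P w v < b), f w) ⊓ himp (g v) c
      ≤ ⨅ w : W, ⨅ (_ : b ≤ P v w),
          (f w ⊔ himp (⨅ u : W, ⨅ (_ : b ≤ P w u), g u) c) := by
  refine le_iInf₂ fun w hvw => ?_
  rcases lt_or_ge (P w v) b with h | h
  · exact inf_le_left.trans ((iInf₂_le w ⟨hvw, h⟩).trans le_sup_left)
  · refine inf_le_right.trans (le_trans ?_ le_sup_right)
    rw [← hres, mul_comm, hres]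
    refine (iInf₂_le v h).trans ?_
    rw [← hres, mul_comm, hres]
end

section
/- Let B be a finite MTL-chain, W a set, P : W × W → B, f : W → B, and v ∈ W. Then ⋀_{b ∈ B} ( b → ⋀_{w ∈ W : P(v,w) ≥ b} f(w) ) = ⋀_{w ∈ W} ( P(v,w) → f(w) ), where an infimum over an empty family equals 1. (The graded necessity □ is definable from the cut modalities □_b.) -/
/-- The graded necessity □ is definable from the cut modalities □_b:
⋀_{b ∈ B} ( b → ⋀_{w : P(v,w) ≥ b} f(w) ) = ⋀_{w ∈ W} ( P(v,w) → f(w) ). -/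
theorem stmt11 (B : Type*) [Fintype B] [CompleteLinearOrder B] [CommMonoid B]
    (himp : B → B → B)
    (hone : (1 : B) = ⊤)
    (hres : ∀ x y z : B, x * y ≤ z ↔ x ≤ himp y z)
    (W : Type*) (P : W → W → B) (f : W → B) (v : W) :
    (⨅ b : B, himp b (⨅ w : W, ⨅ (_ : b ≤ P v w), f w))
      = ⨅ w : W, himp (P v w) (f w) := by
  refine eq_of_forall_le_iff fun x => ?_
  simp only [le_iInf_iff, ← hres]
  refine ⟨fun h w => h (P v w) w le_rfl, fun h b w hb => ?_⟩
  have hw : P v w ≤ himp x (f w) := by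
    rw [← hres, mul_comm]
    exact h w
  rw [mul_comm, hres]
  exact hb.trans hw
end

section
/- Let B be a finite MTL-chain, W a set, P : W × W → B, f : W → B, and v ∈ W. Then ⋁_{b ∈ B} ( b ⊙ ⋁_{w ∈ W : P(v,w) ≥ b} f(w) ) = ⋁_{w ∈ W} ( P(v,w) ⊙ f(w) ), where a supremum over an empty family equals 0. (The graded possibility ◇ is definable from the cut modalities ◇_b.) -/
/-- The graded possibility ◇ is definable from the cut modalities ◇_b:
⋁_{b ∈ B} ( b ⊙ ⋁_{w : P(v,w) ≥ b} f(w) ) = ⋁_{w ∈ W} ( P(v,w) ⊙ f(w) ). -/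
theorem stmt12 (B : Type*) [Fintype B] [CompleteLinearOrder B] [CommMonoid B]
    (himp : B → B → B)
    (hone : (1 : B) = ⊤)
    (hres : ∀ x y z : B, x * y ≤ z ↔ x ≤ himp y z)
    (W : Type*) (P : W → W → B) (f : W → B) (v : W) :
    (⨆ b : B, b * ⨆ w : W, ⨆ (_ : b ≤ P v w), f w)
      = ⨆ w : W, P v w * f w := by
  have mono_left : ∀ {x y : B} (z : B), x ≤ y → x * z ≤ y * z := fun z hxy =>
    (hres _ _ _).2 (hxy.trans ((hres _ _ _).1 le_rfl))
  apply le_antisymm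
  · refine iSup_le fun b => ?_
    rw [mul_comm, hres]
    refine iSup₂_le fun w hw => ?_
    rw [← hres, mul_comm]
    exact (mono_left (f w) hw).trans (le_iSup (fun w => P v w * f w) w)
  · refine iSup_le fun w => ?_
    refine le_trans ?_ (le_iSup (fun b : B => b * ⨆ w : W, ⨆ (_ : b ≤ P v w), f w) (P v w))
    simp only [mul_comm (P v w)]
    exact mono_left _ (le_iSup₂ (f := fun w' (_ : P v w ≤ P v w') => f w') w le_rfl)
end

section
/- Let B be a finite MTL-chain and Δ : B → B the Monteiro-Baaz delta, defined by Δ(1) = 1 and Δ(x) = 0 for x ≠ 1. Let P be a B-valued ∧-preorder on a set W, f : W → B, v ∈ W, and b ∈ B with b ≠ 0. Then ⋀_{a ∈ B} ( Δ( b → ⋁_{w ∈ W} P(v,w) ⊙ Δ((f(w) → a) ⊙ (a → f(w))) ) → a ) = ⋀_{w ∈ W : P(v,w) ≥ b} f(w), where an infimum over an empty family equals 1 and a supremum over an empty family equals 0. (The cut modality □_b is definable from ◇ and Δ.) -/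
/-- The cut modality □_b is definable from ◇ and the Monteiro-Baaz Δ:
⋀_{a ∈ B} ( Δ( b → ⋁_{w} P(v,w) ⊙ Δ((f(w) → a) ⊙ (a → f(w))) ) → a )
  = ⋀_{w : P(v,w) ≥ b} f(w). -/
theorem stmt13 (B : Type*) [Fintype B] [CompleteLinearOrder B] [CommMonoid B]
    (himp : B → B → B)
    (hone : (1 : B) = ⊤)
    (hres : ∀ x y z : B, x * y ≤ z ↔ x ≤ himp y z)
    (D : B → B)
    (hD : ∀ x : B, D x = if x = 1 then 1 else ⊥)
    (W : Type*) (P : W → W → B)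
    (hrefl : ∀ u, P u u = 1)
    (htrans : ∀ u v w, min (P u v) (P v w) ≤ P u w)
    (f : W → B) (v : W) (b : B) (hb : b ≠ ⊥) :
    (⨅ a : B, himp (D (himp b (⨆ w : W, P v w * D (himp (f w) a * himp a (f w))))) a)
      = ⨅ w : W, ⨅ (_ : b ≤ P v w), f w := by
  have le_one (x : B) : x ≤ 1 := hone ▸ le_top
  have himp_eq_one (x y : B) : himp x y = 1 ↔ x ≤ y := by
    rw [← (le_one _).ge_iff_eq, ← hres, one_mul]
  have mul_le_left (x y : B) : x * y ≤ x := by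
    rw [mul_comm, hres, (himp_eq_one x x).2 le_rfl]
    exact le_one y
  have mul_bot' (x : B) : x * ⊥ = ⊥ := by
    rw [mul_comm]
    exact le_bot_iff.1 (mul_le_left ⊥ x)
  have mul_eq_one' (x y : B) : x * y = 1 ↔ x = 1 ∧ y = 1 := by
    refine ⟨fun h => ⟨?_, ?_⟩, fun ⟨hx, hy⟩ => by rw [hx, hy, one_mul]⟩
    · exact le_antisymm (le_one x) (h ▸ mul_le_left x y)
    · exact le_antisymm (le_one y) (h ▸ mul_comm x y ▸ mul_le_left y x)
  have delta_biimp (x a : B) : D (himp x a * himp a x) = if x = a then 1 else ⊥ := by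
    simp only [hD, mul_eq_one', himp_eq_one, le_antisymm_iff]
  have le_iSup_iff' (a : B) :
      b ≤ (⨆ w, P v w * D (himp (f w) a * himp a (f w))) ↔ ∃ w, b ≤ P v w ∧ f w = a := by
    constructor
    · intro h
      have : Nonempty W := ⟨v⟩
      obtain ⟨w, hw⟩ := (Set.range_nonempty
        fun w => P v w * D (himp (f w) a * himp a (f w))).csSup_mem (Set.toFinite _)
      change _ = iSup _ at hw
      rw [← hw] at h
      simp only [delta_biimp] at h
      split_ifs at h with hfw
      · exact ⟨w, by rwa [mul_one] at h, hfw⟩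
      · rw [mul_bot'] at h
        exact absurd (le_bot_iff.1 h) hb
    · rintro ⟨w, hw, hfw⟩
      refine le_iSup_of_le w ?_
      rwa [delta_biimp, if_pos hfw, mul_one]
  have delta_himp (y : B) : D (himp b y) = if b ≤ y then 1 else ⊥ := by
    simp only [hD, himp_eq_one]
  refine eq_of_forall_le_iff fun c => ?_
  simp only [le_iInf_iff, ← hres, delta_himp]
  constructor
  · intro h w hw
    have hc := h (f w)
    rwa [if_pos ((le_iSup_iff' _).2 ⟨w, hw, rfl⟩), mul_one] at hc
  · intro h a
    split_ifs with ha
    · obtain ⟨w, hw, rfl⟩ := (le_iSup_iff' a).1 ha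
      rw [mul_one]
      exact h w hw
    · rw [mul_bot']
      exact bot_le
end

section
/- Let B be a finite MTL-chain, P a B-valued ∧-preorder on a set W, and f, g, h : W → B. Then [f ≤_{∀∃} g] ⊙ [g ≤_{∀∃} h] ≤ [f ≤_{∀∃} h], where [f ≤_{∀∃} g] = ⋀_{u ∈ W} ( f(u) → ⋁_{w ∈ W} P(u,w) ⊙ g(w) ). (⊙-transitivity of the preference relation ≤_{∀∃} on B-valued propositions.) -/
/-- ⊙-transitivity of the preference relation ≤_{∀∃} on B-valued propositions:
[f ≤_{∀∃} g] ⊙ [g ≤_{∀∃} h] ≤ [f ≤_{∀∃} h]. -/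
theorem stmt15 (B : Type*) [Fintype B] [CompleteLinearOrder B] [CommMonoid B]
    (himp : B → B → B)
    (hone : (1 : B) = ⊤)
    (hres : ∀ x y z : B, x * y ≤ z ↔ x ≤ himp y z)
    (W : Type*) (P : W → W → B)
    (hrefl : ∀ u, P u u = 1)
    (htrans : ∀ u v w, min (P u v) (P v w) ≤ P u w)
    (f g h : W → B) :
    (⨅ u : W, himp (f u) (⨆ w : W, P u w * g w))
        * (⨅ u : W, himp (g u) (⨆ w : W, P u w * h w))
      ≤ ⨅ u : W, himp (f u) (⨆ w : W, P u w * h w) := by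
  have mono : ∀ {x x' : B} (y : B), x ≤ x' → x * y ≤ x' * y := fun y hx =>
    (hres _ _ _).2 (hx.trans ((hres _ _ _).1 le_rfl))
  have mul_le_right : ∀ x y : B, x * y ≤ y := fun x y => by
    simpa using mono y (hone ▸ le_top : x ≤ 1)
  have mul_le_min : ∀ x y : B, x * y ≤ min x y := fun x y =>
    le_min (mul_comm x y ▸ mul_le_right y x) (mul_le_right x y)
  have iSup_mul_le : ∀ (k : W → B) (y z : B), (∀ w, k w * y ≤ z) → (⨆ w, k w) * y ≤ z :=
    fun k y z hk => (hres _ _ _).2 (iSup_le fun w => (hres _ _ _).1 (hk w))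
  refine le_iInf fun u => (hres _ _ _).1 ?_
  set a := ⨅ u : W, himp (f u) (⨆ w : W, P u w * g w)
  set b := ⨅ u : W, himp (g u) (⨆ w : W, P u w * h w)
  have ha : a * f u ≤ ⨆ w, P u w * g w := (hres _ _ _).2 (iInf_le _ u)
  have hb : ∀ w, b * g w ≤ ⨆ v, P w v * h v := fun w => (hres _ _ _).2 (iInf_le _ w)
  rw [mul_right_comm]
  refine (mono b ha).trans (iSup_mul_le _ _ _ fun w => ?_)
  rw [mul_assoc, mul_comm (g w), mul_comm (P u w)]
  refine (mono (P u w) (hb w)).trans (iSup_mul_le _ _ _ fun v => ?_)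
  rw [mul_comm, ← mul_assoc]
  exact (mono (h v) ((mul_le_min _ _).trans (htrans u w v))).trans
    (le_iSup (fun v => P u v * h v) v)
end

section
/- Let B be a finite MTL-chain, P a B-valued ∧-preorder on a set W with strict part P^<, and f, g, h : W → B. Then [f <_{∀∃} g] ⊙ [g <_{∀∃} h] ≤ [f <_{∀∃} h], where [f <_{∀∃} g] = ⋀_{u ∈ W} ( f(u) → ⋁_{w ∈ W} P^<(u,w) ⊙ g(w) ). (⊙-transitivity of the strict preference relation <_{∀∃} on B-valued propositions.) -/
/-- The strict part of a min-transitive relation valued in a linear order is min-transitive. -/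
theorem strictPart_min_trans {B W : Type*} [LinearOrder B] [OrderBot B] {P Ps : W → W → B}
    (htrans : ∀ u v w, min (P u v) (P v w) ≤ P u w)
    (hPs : ∀ u v, Ps u v = if P v u < P u v then P u v else ⊥) (u v w : W) :
    min (Ps u v) (Ps v w) ≤ Ps u w := by
  rw [hPs u v, hPs v w, hPs u w]
  by_cases huv : P v u < P u v
  swap
  · simp [huv]
  by_cases hvw : P w v < P v w
  swap
  · simp [hvw]
  have huvw := htrans u v w
  have huw : P w u < P u w := by
    by_contra! hle
    have hvwu := htrans v w u
    have hwuv := htrans w u v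
    grind
  simpa [huv, hvw, huw] using huvw

/-- ⊙-transitivity of the strict preference relation <_{∀∃} on B-valued propositions:
[f <_{∀∃} g] ⊙ [g <_{∀∃} h] ≤ [f <_{∀∃} h], with P^< the strict part of P. -/
theorem stmt16 (B : Type*) [Fintype B] [CompleteLinearOrder B] [CommMonoid B]
    (himp : B → B → B)
    (hone : (1 : B) = ⊤)
    (hres : ∀ x y z : B, x * y ≤ z ↔ x ≤ himp y z)
    (W : Type*) (P : W → W → B)
    (hrefl : ∀ u, P u u = 1)
    (htrans : ∀ u v w, min (P u v) (P v w) ≤ P u w)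
    (Ps : W → W → B)
    (hPs : ∀ u v, Ps u v = if P v u < P u v then P u v else ⊥)
    (f g h : W → B) :
    (⨅ u : W, himp (f u) (⨆ w : W, Ps u w * g w))
        * (⨅ u : W, himp (g u) (⨆ w : W, Ps u w * h w))
      ≤ ⨅ u : W, himp (f u) (⨆ w : W, Ps u w * h w) := by
  have mul_mono_left : ∀ {a b : B} (c : B), a ≤ b → a * c ≤ b * c := fun c hab =>
    (hres _ _ _).2 (hab.trans ((hres _ _ _).1 le_rfl))
  have mul_le_left : ∀ a b : B, a * b ≤ a := fun a b => by
    have hb : b * a ≤ 1 * a := mul_mono_left a (hone ▸ le_top)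
    rwa [one_mul, mul_comm] at hb
  have hPs_mul : ∀ u v w, Ps u v * Ps v w ≤ Ps u w := fun u v w =>
    (le_min (mul_le_left _ _) (mul_comm (Ps u v) _ ▸ mul_le_left _ _)).trans
      (strictPart_min_trans htrans hPs u v w)
  refine le_iInf fun u => (hres _ _ _).1 ?_
  set F := ⨅ u : W, himp (f u) (⨆ w : W, Ps u w * g w)
  set G := ⨅ u : W, himp (g u) (⨆ w : W, Ps u w * h w)
  have hF : F * f u ≤ ⨆ w : W, Ps u w * g w := (hres _ _ _).2 (iInf_le _ u)
  have hG : ∀ w, G * g w ≤ ⨆ v : W, Ps w v * h v := fun w => (hres _ _ _).2 (iInf_le _ w)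
  rw [mul_right_comm]
  refine (mul_mono_left G hF).trans ((hres _ _ _).2 (iSup_le fun w => (hres _ _ _).1 ?_))
  rw [mul_assoc, mul_comm (g w), mul_comm]
  refine (mul_mono_left _ (hG w)).trans ((hres _ _ _).2 (iSup_le fun v => (hres _ _ _).1 ?_))
  rw [mul_comm, ← mul_assoc]
  exact (mul_mono_left _ (hPs_mul u w v)).trans (le_iSup (fun w => Ps u w * h w) v)
end
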